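/- arXiv:1707.07762 — 3 statements merged into one kernel-verified Lean document; each statement's English description precedes it below -/
import Mathlib

section
/- For t > 0, real ν, and complex ξ, η with Re(ξ) > 0 and Re(η) > 0, the integral ∫₀^∞ x^{ν−1} e^{−(ξx + ηt/x)} dx equals 2 (ηt/ξ)^{ν/2} K_{|ν|}(2√(tηξ)), where K is the modified Bessel function of the second kind. -/
open MeasureTheory

/-- Modified Bessel function of the second kind (complex argument), via
`K_ν(z) = (1/2) ∫_{-∞}^∞ exp(-z cosh τ + ν τ) dτ`, valid for `Re z > 0`. -/
noncomputable def besselK (ν : ℝ) (z : ℂ) : ℂ :=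
  (1 / 2) * ∫ τ : ℝ, Complex.exp (-z * Real.cosh τ + ν * τ)

open Filter Topology

/-- Horizontal contour shift: the integral of an entire function along the real line may be moved to
the line of imaginary part `c` when the function is dominated in the strip between both lines. -/
theorem integral_add_mul_I_eq_of_norm_le {f : ℂ → ℂ} (hf : Differentiable ℂ f) {c : ℝ} {B : ℝ → ℝ}
    (hB : Integrable B) (hB_top : Tendsto B atTop (𝓝 0)) (hB_bot : Tendsto B atBot (𝓝 0))
    (hfB : ∀ x : ℝ, ∀ y ∈ Set.uIcc 0 c, ‖f (x + y * Complex.I)‖ ≤ B x) :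
    ∫ x : ℝ, f (x + c * Complex.I) = ∫ x : ℝ, f x := by
  have hcont := hf.continuous
  have hline (y : ℝ) (hy : y ∈ Set.uIcc 0 c) :
      Tendsto (fun T : ℝ => ∫ x in (-T)..T, f (x + y * Complex.I)) atTop
        (𝓝 (∫ x : ℝ, f (x + y * Complex.I))) := by
    refine intervalIntegral_tendsto_integral ?_ tendsto_neg_atTop_atBot tendsto_id
    refine hB.mono' (Continuous.aestronglyMeasurable (by fun_prop)) (.of_forall fun x => hfB x y hy)
  have hside (s : ℝ → ℝ) (hs : Tendsto (fun T => B (s T)) atTop (𝓝 0)) :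
      Tendsto (fun T : ℝ => Complex.I • ∫ y in (0 : ℝ)..c, f (s T + y * Complex.I)) atTop
        (𝓝 0) := by
    refine squeeze_zero_norm (a := fun T => B (s T) * |c - 0|) (fun T => ?_)
      (by simpa using hs.mul_const |c - 0|)
    rw [norm_smul, Complex.norm_I, one_mul]
    exact intervalIntegral.norm_integral_le_of_norm_le_const
      fun y hy => hfB _ y (Set.uIoc_subset_uIcc hy)
  have hrect (T : ℝ) : (((∫ x in (-T)..T, f (x + (0 : ℝ) * Complex.I)) -
      ∫ x in (-T)..T, f (x + c * Complex.I)) +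
      Complex.I • ∫ y in (0 : ℝ)..c, f (T + y * Complex.I)) -
      Complex.I • (∫ y in (0 : ℝ)..c, f ((-T : ℝ) + y * Complex.I)) = 0 := by
    simpa using Complex.integral_boundary_rect_eq_zero_of_differentiableOn f (-T)
      (T + c * Complex.I) hf.differentiableOn
  have hlim := (((hline 0 Set.left_mem_uIcc).sub (hline c Set.right_mem_uIcc)).add
    (hside id hB_top)).sub (hside Neg.neg (hB_bot.comp tendsto_neg_atTop_atBot))
  have h_zero := tendsto_nhds_unique (hlim.congr hrect) tendsto_const_nhds
  simp only [add_zero, sub_zero, Complex.ofReal_zero, zero_mul] at h_zero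
  exact (sub_eq_zero.mp h_zero).symm

theorem sub_mul_exp_sub_mul_exp_neg_le (ν x : ℝ) {δ p q : ℝ} (hδ : 0 < δ) (hp : δ ≤ p)
    (hq : δ ≤ q) :
    ν * x - p * Real.exp x - q * Real.exp (-x) ≤ ν ^ 2 / δ + -(δ / 4) * x ^ 2 := by
  have hexp : x ^ 2 / 2 ≤ Real.exp x + Real.exp (-x) := by
    have h := Real.quadratic_le_exp_of_nonneg (abs_nonneg x)
    rw [sq_abs] at h
    have := Real.exp_abs_le x
    linarith [abs_nonneg x]
  have hνx : ν * x ≤ ν ^ 2 / δ + δ / 4 * x ^ 2 := by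
    have h : ν ^ 2 / δ + δ / 4 * x ^ 2 - ν * x = (ν - δ * x / 2) ^ 2 / δ := by
      field_simp
      ring
    have : 0 ≤ (ν - δ * x / 2) ^ 2 / δ := by positivity
    linarith
  have h₁ := mul_le_mul_of_nonneg_right hp (Real.exp_pos x).le
  have h₂ := mul_le_mul_of_nonneg_right hq (Real.exp_pos (-x)).le
  nlinarith [mul_le_mul_of_nonneg_left hexp hδ.le]

/-- Complex translation of the integration variable in
`∫ exp (ν x - a exp x - b exp (-x))`, as long as the coefficients keep a positive real part. -/
theorem integral_cexp_sub_exp_sub_exp_neg_add (ν : ℝ) (a b c : ℂ)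
    (ha : ∀ y ∈ Set.uIcc 0 c.im, 0 < (a * Complex.exp (y * Complex.I)).re)
    (hb : ∀ y ∈ Set.uIcc 0 c.im, 0 < (b * Complex.exp (-(y * Complex.I))).re) :
    ∫ x : ℝ, Complex.exp (ν * (x + c) - a * Complex.exp (x + c) - b * Complex.exp (-(x + c))) =
      ∫ x : ℝ, Complex.exp (ν * x - a * Complex.exp x - b * Complex.exp (-x)) := by
  let p : ℝ → ℝ := fun y => (a * Complex.exp (y * Complex.I)).re
  let q : ℝ → ℝ := fun y => (b * Complex.exp (-(y * Complex.I))).re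
  have hpq : Continuous fun y => min (p y) (q y) := by
    refine Continuous.min ?_ ?_
    · exact Complex.continuous_re.comp (by fun_prop)
    · exact Complex.continuous_re.comp (by fun_prop)
  obtain ⟨y₀, hy₀, h_isMin⟩ := (isCompact_uIcc (a := (0 : ℝ)) (b := c.im)).exists_isMinOn
    Set.nonempty_uIcc hpq.continuousOn
  have hδ : 0 < min (p y₀) (q y₀) := lt_min (ha y₀ hy₀) (hb y₀ hy₀)
  have hmin : ∀ y ∈ Set.uIcc 0 c.im, min (p y₀) (q y₀) ≤ min (p y) (q y) :=
    fun y hy => h_isMin hy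
  generalize min (p y₀) (q y₀) = δ at hmin hδ
  let f : ℂ → ℂ := fun z => Complex.exp (ν * z - a * Complex.exp z - b * Complex.exp (-z))
  have hf : Differentiable ℂ f := by fun_prop
  have hnorm (x y : ℝ) : ‖f (x + y * Complex.I)‖ =
      Real.exp (ν * x - p y * Real.exp x - q y * Real.exp (-x)) := by
    have hp : a * Complex.exp (x + y * Complex.I) =
        (Real.exp x : ℝ) * (a * Complex.exp (y * Complex.I)) := by
      rw [Complex.exp_add]
      push_cast
      ring
    have hq : b * Complex.exp (-(x + y * Complex.I)) =
        (Real.exp (-x) : ℝ) * (b * Complex.exp (-(y * Complex.I))) := by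
      rw [neg_add, Complex.exp_add]
      push_cast
      ring
    simp only [f]
    rw [Complex.norm_exp, hp, hq, Complex.sub_re, Complex.sub_re, Complex.re_ofReal_mul,
      Complex.re_ofReal_mul, Complex.re_ofReal_mul]
    simp [p, q, mul_comm]
  let B : ℝ → ℝ := fun x => Real.exp (ν ^ 2 / δ) * Real.exp (-(δ / 4) * x ^ 2)
  have hδ4 : -(δ / 4) < 0 := by linarith
  have hfB (x : ℝ) (y : ℝ) (hy : y ∈ Set.uIcc 0 c.im) : ‖f (x + y * Complex.I)‖ ≤ B x := by
    have h := hmin y hy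
    simp only [hnorm, B]
    rw [← Real.exp_add]
    exact Real.exp_le_exp.mpr
      (sub_mul_exp_sub_mul_exp_neg_le ν x hδ (h.trans (min_le_left _ _))
        (h.trans (min_le_right _ _)))
  have hB : Integrable B := (integrable_exp_neg_mul_sq (by linarith)).const_mul _
  have hB_top : Tendsto B atTop (𝓝 0) := by
    have h := (Real.tendsto_exp_atBot.comp
      ((tendsto_pow_atTop two_ne_zero).const_mul_atTop_of_neg hδ4)).const_mul
        (Real.exp (ν ^ 2 / δ))
    simpa [B] using h
  have hB_bot : Tendsto B atBot (𝓝 0) := by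
    have h := hB_top.comp tendsto_neg_atBot_atTop
    simpa [B, Function.comp_def] using h
  rw [← integral_add_mul_I_eq_of_norm_le hf hB hB_top hB_bot hfB,
    ← integral_add_right_eq_self (fun x : ℝ => f (x + c.im * Complex.I)) c.re]
  refine integral_congr_ae (.of_forall fun x => ?_)
  have h : ((x + c.re : ℝ) : ℂ) + c.im * Complex.I = x + c := by
    conv_rhs => rw [← Complex.re_add_im c]
    push_cast
    ring
  simp only [h, f]

theorem re_mul_exp_mul_I_pos {z : ℂ} (hz : z ≠ 0) {y : ℝ} (h : |z.arg + y| < Real.pi / 2) :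
    0 < (z * Complex.exp (y * Complex.I)).re := by
  rw [← Complex.norm_mul_exp_arg_mul_I z, mul_assoc, ← Complex.exp_add, ← add_mul,
    ← Complex.ofReal_add, Complex.re_ofReal_mul, Complex.exp_ofReal_mul_I_re]
  exact mul_pos (norm_pos_iff.mpr hz) (Real.cos_pos_of_mem_Ioo (abs_lt.mp h))

theorem integral_Ioi_rpow_mul_eq_integral_exp (ν : ℝ) (g : ℝ → ℂ) :
    ∫ x in Set.Ioi (0 : ℝ), ((x ^ (ν - 1) : ℝ) : ℂ) * g x =
      ∫ x : ℝ, Complex.exp (ν * x) * g (Real.exp x) := by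
  rw [← Real.range_exp, ← Set.image_univ,
    integral_image_eq_integral_abs_deriv_smul MeasurableSet.univ
      (fun x _ => (Real.hasDerivAt_exp x).hasDerivWithinAt) Real.exp_injective.injOn,
    Measure.restrict_univ]
  refine integral_congr_ae (.of_forall fun x => ?_)
  simp only [Complex.real_smul, abs_of_pos (Real.exp_pos x)]
  rw [← mul_assoc, ← Complex.ofReal_mul, ← Real.exp_mul, ← Real.exp_add]
  push_cast
  ring_nf

theorem besselK_neg (ν : ℝ) (z : ℂ) : besselK (-ν) z = besselK ν z := by
  unfold besselK
  rw [← integral_neg_eq_self]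
  simp

theorem besselK_abs (ν : ℝ) (z : ℂ) : besselK |ν| z = besselK ν z := by
  rcases abs_choice ν with h | h <;> simp only [h, besselK_neg]

theorem two_mul_besselK_two_mul (ν : ℝ) (w : ℂ) :
    2 * besselK ν (2 * w) =
      ∫ x : ℝ, Complex.exp (ν * x - w * Complex.exp x - w * Complex.exp (-x)) := by
  unfold besselK
  rw [← mul_assoc, mul_one_div_cancel two_ne_zero, one_mul]
  refine integral_congr_ae (.of_forall fun x => ?_)
  simp only [Complex.ofReal_cosh, Complex.cosh]
  ring_nf

theorem integral_cexp_sub_exp_sub_exp_neg_eq_besselK (ν : ℝ) {a b : ℂ} (ha : 0 < a.re)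
    (hb : 0 < b.re) :
    ∫ x : ℝ, Complex.exp (ν * x - a * Complex.exp x - b * Complex.exp (-x)) =
      2 * (b / a) ^ ((ν / 2 : ℝ) : ℂ) * besselK ν (2 * (b * a) ^ ((1 / 2 : ℝ) : ℂ)) := by
  have ha0 : a ≠ 0 := by rintro rfl; simp at ha
  have hb0 : b ≠ 0 := by rintro rfl; simp at hb
  have ha_arg := abs_lt.mp (Complex.abs_arg_lt_pi_div_two_iff.mpr (.inl ha))
  have hb_arg := abs_lt.mp (Complex.abs_arg_lt_pi_div_two_iff.mpr (.inl hb))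
  have ha_pi : a.arg ≠ Real.pi := by linarith [Real.pi_pos, ha_arg.2]
  have hlog_mul : Complex.log (b * a) = Complex.log b + Complex.log a :=
    Complex.log_mul hb0 ha0 ⟨by linarith, by linarith⟩
  have hlog_div : Complex.log (b / a) = Complex.log b - Complex.log a := by
    have harg : a⁻¹.arg = -a.arg := by rw [Complex.arg_inv, if_neg ha_pi]
    rw [div_eq_mul_inv, Complex.log_mul hb0 (inv_ne_zero ha0), Complex.log_inv a ha_pi,
      ← sub_eq_add_neg]
    rw [harg]
    exact ⟨by linarith, by linarith⟩
  set c : ℂ := (Complex.log b - Complex.log a) / 2 with hc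
  set w : ℂ := (b * a) ^ ((1 / 2 : ℝ) : ℂ) with hw
  have hw_exp : w = Complex.exp ((Complex.log b + Complex.log a) / 2) := by
    rw [hw, Complex.cpow_def_of_ne_zero (mul_ne_zero hb0 ha0), hlog_mul]
    push_cast
    ring_nf
  have haw : a * Complex.exp c = w := by
    rw [hw_exp, ← Complex.exp_log ha0, ← Complex.exp_add, Complex.exp_log ha0, hc]
    ring_nf
  have hbw : b * Complex.exp (-c) = w := by
    rw [hw_exp, ← Complex.exp_log hb0, ← Complex.exp_add, Complex.exp_log hb0, hc]
    ring_nf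
  have hpow : (b / a) ^ ((ν / 2 : ℝ) : ℂ) = Complex.exp (ν * c) := by
    rw [Complex.cpow_def_of_ne_zero (div_ne_zero hb0 ha0), hlog_div, hc]
    push_cast
    ring_nf
  have hc_im : c.im = (b.arg - a.arg) / 2 := by simp [hc, Complex.log_im]
  have hy (y : ℝ) (hy : y ∈ Set.uIcc 0 c.im) :
      |a.arg + y| < Real.pi / 2 ∧ |b.arg + -y| < Real.pi / 2 := by
    rw [hc_im, Set.mem_uIcc] at hy
    rw [abs_lt, abs_lt]
    rcases hy with hy | hy <;> refine ⟨⟨?_, ?_⟩, ?_, ?_⟩ <;> linarith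
  rw [← integral_cexp_sub_exp_sub_exp_neg_add ν a b c
      (fun y hyc => re_mul_exp_mul_I_pos ha0 (hy y hyc).1)
      (fun y hyc => by simpa using re_mul_exp_mul_I_pos hb0 (hy y hyc).2),
    mul_right_comm, two_mul_besselK_two_mul, hpow, mul_comm, ← integral_const_mul]
  refine integral_congr_ae (.of_forall fun x => ?_)
  simp only []
  rw [← Complex.exp_add, neg_add, Complex.exp_add (x : ℂ) c, Complex.exp_add (-x : ℂ) (-c)]
  congr 1
  linear_combination (-Complex.exp x) * haw - Complex.exp (-x) * hbw

theorem integral_rpow_exp_eq_besselK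
    (ν : ℝ) (ξ η : ℂ) (hξ : 0 < ξ.re) (hη : 0 < η.re) (t : ℝ) (ht : 0 < t) :
    (∫ x in Set.Ioi (0 : ℝ),
        ((x ^ (ν - 1) : ℝ) : ℂ) * Complex.exp (-(ξ * x + η * t / x)))
      = 2 * (η * t / ξ) ^ ((ν / 2 : ℝ) : ℂ) *
          besselK |ν| (2 * ((t : ℂ) * η * ξ) ^ ((1 / 2 : ℝ) : ℂ)) := by
  have hη' : 0 < (η * t).re := by
    rw [Complex.re_mul_ofReal]
    exact mul_pos hη ht
  rw [integral_Ioi_rpow_mul_eq_integral_exp ν fun x => Complex.exp (-(ξ * x + η * t / x)),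
    besselK_abs, mul_comm (t : ℂ) η, ← integral_cexp_sub_exp_sub_exp_neg_eq_besselK ν hξ hη']
  refine integral_congr_ae (.of_forall fun x => ?_)
  simp only []
  rw [← Complex.exp_add, Complex.ofReal_exp, Complex.exp_neg (x : ℂ)]
  ring_nf
end

section
/- Let X and Y be independent non-negative random variables with PDFs f(x) = x^{α−1} Σ_{m=1}^M a_m e^{−ξ_m x} and g(y) = y^{β−1} Σ_{n=1}^N b_n e^{−η_n y}, with α, β > 0 and Re(ξ_m), Re(η_n) > 0. Then the PDF of the product XY is p(t) = 2 t^{(α+β−2)/2} Σ_{m=1}^M Σ_{n=1}^N a_m b_n (η_n/ξ_m)^{(α−β)/2} K_{|α−β|}(2√(t ξ_m η_n)) for t > 0. -/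
open MeasureTheory

open Filter Topology

/-- The integral of an entire function along a horizontal line does not change when the line is
moved, provided the function is dominated on the strip by an integrable function vanishing at
infinity. -/
theorem integral_add_mul_I_eq_of_dominated {f : ℂ → ℂ} (hf : Differentiable ℂ f) {B : ℝ → ℝ}
    (hB : Integrable B) (htop : Tendsto B atTop (𝓝 0)) (hbot : Tendsto B atBot (𝓝 0)) (θ : ℝ)
    (hfB : ∀ x : ℝ, ∀ y ∈ Set.uIcc 0 θ, ‖f (x + y * Complex.I)‖ ≤ B x) :
    ∫ x : ℝ, f (x + θ * Complex.I) = ∫ x : ℝ, f x := by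
  have hint : ∀ y ∈ Set.uIcc 0 θ, Integrable fun x : ℝ => f (x + y * Complex.I) := fun y hy =>
    hB.mono' (hf.continuous.comp (by fun_prop)).aestronglyMeasurable
      (Eventually.of_forall fun x => hfB x y hy)
  have hside : ∀ l : Filter ℝ, Tendsto B l (𝓝 0) →
      Tendsto (fun R : ℝ => ∫ y : ℝ in (0 : ℝ)..θ, f (R + y * Complex.I)) l (𝓝 0) := by
    intro l hl
    refine squeeze_zero_norm (a := fun R => B R * |θ - 0|) (fun R => ?_)
      (by simpa using hl.mul_const |θ - 0|)
    exact intervalIntegral.norm_integral_le_of_norm_le_const fun y hy =>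
      hfB R y (Set.uIoc_subset_uIcc hy)
  have hline : ∀ y ∈ Set.uIcc 0 θ, Tendsto (fun R : ℝ => ∫ x : ℝ in -R..R, f (x + y * Complex.I))
      atTop (𝓝 (∫ x : ℝ, f (x + y * Complex.I))) := fun y hy =>
    intervalIntegral_tendsto_integral (hint y hy) tendsto_neg_atTop_atBot tendsto_id
  have hlim := (((hline 0 Set.left_mem_uIcc).sub (hline θ Set.right_mem_uIcc)).add
    ((hside _ htop).const_smul Complex.I)).sub
      (((hside _ hbot).comp tendsto_neg_atTop_atBot).const_smul Complex.I)
  have hzero : ∀ R : ℝ, (∫ x : ℝ in -R..R, f (x + (0 : ℝ) * Complex.I)) -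
      (∫ x : ℝ in -R..R, f (x + θ * Complex.I)) +
      Complex.I • (∫ y : ℝ in (0 : ℝ)..θ, f (R + y * Complex.I)) -
      Complex.I • (∫ y : ℝ in (0 : ℝ)..θ, f ((-R : ℝ) + y * Complex.I)) = 0 := by
    intro R
    simpa using Complex.integral_boundary_rect_eq_zero_of_differentiableOn f (-R : ℝ)
      (R + θ * Complex.I) hf.differentiableOn
  have h := tendsto_nhds_unique hlim
    (tendsto_const_nhds.congr fun R => (hzero R).symm)
  simp only [smul_zero, add_zero, sub_zero, Complex.ofReal_zero, zero_mul] at h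
  exact (sub_eq_zero.mp h).symm

theorem sq_div_two_le_exp_add_exp_neg (x : ℝ) : x ^ 2 / 2 ≤ Real.exp x + Real.exp (-x) := by
  rcases le_total 0 x with h | h
  · nlinarith [Real.quadratic_le_exp_of_nonneg h, Real.exp_pos (-x)]
  · nlinarith [Real.quadratic_le_exp_of_nonneg (neg_nonneg.2 h), Real.exp_pos x]

theorem tendsto_neg_mul_sq_add_mul_cobounded {ε : ℝ} (hε : 0 < ε) (δ : ℝ) :
    Tendsto (fun x : ℝ => -ε * x ^ 2 + δ * x) (Bornology.cobounded ℝ) atBot := by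
  have h : Tendsto (fun x : ℝ => |x|) (Bornology.cobounded ℝ) atTop :=
    tendsto_norm_cobounded_atTop
  have h1 : Tendsto (fun x : ℝ => |x| * (-ε * |x| + |δ|)) (Bornology.cobounded ℝ) atBot :=
    h.atTop_mul_atBot₀ (tendsto_atBot_add_const_right _ _ (h.const_mul_atTop_of_neg (by linarith)))
  refine tendsto_atBot_mono (fun x => ?_) h1
  have h2 : δ * x ≤ |δ| * |x| := (le_abs_self _).trans (abs_mul δ x).le
  nlinarith [sq_abs x]

/-- The exponential integrand `exp (-e^(A + z) - e^(B - z) + δ z)`. -/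
noncomputable def besselKernel (A B : ℂ) (δ : ℝ) (z : ℂ) : ℂ :=
  Complex.exp (-Complex.exp (A + z) - Complex.exp (B - z) + δ * z)

theorem differentiable_besselKernel (A B : ℂ) (δ : ℝ) :
    Differentiable ℂ (besselKernel A B δ) := by
  unfold besselKernel
  fun_prop

theorem norm_besselKernel_le {A B : ℂ} {δ ε x y : ℝ}
    (hA : ε ≤ (Complex.exp (A + y * Complex.I)).re)
    (hB : ε ≤ (Complex.exp (B - y * Complex.I)).re) (hε : 0 < ε) :
    ‖besselKernel A B δ (x + y * Complex.I)‖ ≤ Real.exp (-(ε / 2) * x ^ 2 + δ * x) := by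
  have e1 : Complex.exp (A + (x + y * Complex.I)) =
      (Real.exp x : ℝ) * Complex.exp (A + y * Complex.I) := by
    rw [Complex.ofReal_exp, ← Complex.exp_add]; ring_nf
  have e2 : Complex.exp (B - (x + y * Complex.I)) =
      (Real.exp (-x) : ℝ) * Complex.exp (B - y * Complex.I) := by
    rw [Complex.ofReal_exp, ← Complex.exp_add]; push_cast; ring_nf
  rw [besselKernel, Complex.norm_exp, Real.exp_le_exp, e1, e2]
  simp only [Complex.add_re, Complex.sub_re, Complex.neg_re,
    Complex.ofReal_re, Complex.mul_re, Complex.I_re, Complex.I_im, Complex.ofReal_im, mul_zero,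
    zero_mul, sub_zero, add_zero]
  have h1 := mul_le_mul_of_nonneg_left hA (Real.exp_pos x).le
  have h2 := mul_le_mul_of_nonneg_left hB (Real.exp_pos (-x)).le
  nlinarith [sq_div_two_le_exp_add_exp_neg x]

theorem integrable_exp_neg_mul_sq_add_mul {ε : ℝ} (hε : 0 < ε) (δ : ℝ) :
    Integrable fun x : ℝ => Real.exp (-ε * x ^ 2 + δ * x) := by
  have h := (integrable_cexp_quadratic (b := (ε : ℂ)) (by simpa using hε) δ 0).norm
  refine h.congr (Eventually.of_forall fun x => ?_)
  simp only [Complex.norm_exp]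
  congr 1
  norm_cast
  simp

theorem exp_re_pos_of_abs_im_lt {z : ℂ} (h : |z.im| < Real.pi / 2) : 0 < (Complex.exp z).re := by
  rw [Complex.exp_re]
  exact mul_pos (Real.exp_pos _) (Real.cos_pos_of_mem_Ioo (abs_lt.1 h))

theorem integrable_besselKernel {A B : ℂ} (δ : ℝ) (hA : |A.im| < Real.pi / 2)
    (hB : |B.im| < Real.pi / 2) : Integrable fun x : ℝ => besselKernel A B δ x := by
  have hε := lt_min (exp_re_pos_of_abs_im_lt hA) (exp_re_pos_of_abs_im_lt hB)
  refine (integrable_exp_neg_mul_sq_add_mul (half_pos hε) δ).mono'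
    ((differentiable_besselKernel A B δ).continuous.comp
      Complex.continuous_ofReal).aestronglyMeasurable (Eventually.of_forall fun x => ?_)
  simpa using norm_besselKernel_le (A := A) (B := B) (δ := δ) (x := x) (y := 0)
    (by simp) (by simp) hε

theorem integral_besselKernel_add_mul_I {A B : ℂ} (δ θ : ℝ) (hA : |A.im| < Real.pi / 2)
    (hB : |B.im| < Real.pi / 2) (hAθ : |A.im + θ| < Real.pi / 2)
    (hBθ : |B.im - θ| < Real.pi / 2) :
    ∫ x : ℝ, besselKernel A B δ (x + θ * Complex.I) = ∫ x : ℝ, besselKernel A B δ x := by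
  have hpos : ∀ y ∈ Set.uIcc 0 θ, 0 < min (Complex.exp (A + y * Complex.I)).re
      (Complex.exp (B - y * Complex.I)).re := by
    intro y hy
    rw [abs_lt] at *
    refine lt_min (exp_re_pos_of_abs_im_lt ?_) (exp_re_pos_of_abs_im_lt ?_) <;>
    · simp only [Complex.add_im, Complex.sub_im, Complex.im_ofReal_mul, Complex.I_im, mul_one]
      rw [abs_lt]
      rcases Set.mem_uIcc.1 hy with h | h <;> constructor <;> linarith
  obtain ⟨y₀, hy₀, hmin⟩ := isCompact_uIcc.exists_isMinOn (s := Set.uIcc 0 θ)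
    Set.nonempty_uIcc (f := fun y : ℝ => min (Complex.exp (A + y * Complex.I)).re
      (Complex.exp (B - y * Complex.I)).re) (by fun_prop)
  set ε := min (Complex.exp (A + y₀ * Complex.I)).re (Complex.exp (B - y₀ * Complex.I)).re
  have hε : 0 < ε := hpos y₀ hy₀
  have hlim := Real.tendsto_exp_atBot.comp
    (tendsto_neg_mul_sq_add_mul_cobounded (half_pos hε) δ)
  refine integral_add_mul_I_eq_of_dominated (differentiable_besselKernel A B δ)
    (integrable_exp_neg_mul_sq_add_mul (half_pos hε) δ)
    (hlim.mono_left ?_) (hlim.mono_left ?_) θ fun x y hy => ?_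
  · rw [IsOrderBornology.cobounded_eq]
    exact le_sup_right
  · rw [IsOrderBornology.cobounded_eq]
    exact le_sup_left
  · have h : ε ≤ min _ _ := hmin hy
    exact norm_besselKernel_le (h.trans (min_le_left _ _)) (h.trans (min_le_right _ _)) hε

theorem integral_besselKernel {A B : ℂ} (δ : ℝ) (hA : |A.im| < Real.pi / 2)
    (hB : |B.im| < Real.pi / 2) :
    ∫ x : ℝ, besselKernel A B δ x =
      2 * Complex.exp ((B - A) * (δ / 2)) * besselK δ (2 * Complex.exp ((A + B) / 2)) := by
  have hκ : (B - A) / 2 = (((B.re - A.re) / 2 : ℝ) : ℂ) +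
      (((B.im - A.im) / 2 : ℝ) : ℂ) * Complex.I := by
    apply Complex.ext <;> simp
  have hmem : |A.im + (B.im - A.im) / 2| < Real.pi / 2 ∧
      |B.im - (B.im - A.im) / 2| < Real.pi / 2 := by
    simp only [abs_lt] at *
    refine ⟨⟨?_, ?_⟩, ?_, ?_⟩ <;> linarith
  rw [← integral_besselKernel_add_mul_I δ ((B.im - A.im) / 2) hA hB hmem.1 hmem.2,
    ← integral_add_right_eq_self _ ((B.re - A.re) / 2), besselK, ← mul_assoc,
    show 2 * Complex.exp ((B - A) * (δ / 2)) * (1 / 2) = Complex.exp ((B - A) * (δ / 2)) by ring,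
    ← integral_const_mul]
  refine integral_congr_ae (Eventually.of_forall fun x => ?_)
  have hx : ((x + (B.re - A.re) / 2 : ℝ) : ℂ) + (((B.im - A.im) / 2 : ℝ) : ℂ) * Complex.I =
      x + (B - A) / 2 := by
    rw [hκ]; push_cast; ring
  simp only [hx]
  rw [besselKernel, ← Complex.exp_add, Complex.ofReal_cosh, Complex.cosh,
    show A + (x + (B - A) / 2) = (A + B) / 2 + x by ring,
    show B - (x + (B - A) / 2) = (A + B) / 2 + -x by ring,
    Complex.exp_add ((A + B) / 2) x, Complex.exp_add ((A + B) / 2) (-x)]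
  congr 1
  ring

theorem integral_Ioi_eq_integral_exp (F : ℝ → ℝ) :
    ∫ x in Set.Ioi (0 : ℝ), F x = ∫ τ : ℝ, Real.exp τ * F (Real.exp τ) := by
  have h := integral_image_eq_integral_abs_deriv_smul (s := Set.univ) (f := Real.exp)
    (f' := Real.exp) MeasurableSet.univ
    (fun x _ => (Real.hasDerivAt_exp x).hasDerivWithinAt) Real.exp_injective.injOn F
  simpa [Set.image_univ, Real.range_exp] using h

theorem abs_log_im_lt {z : ℂ} (hz : 0 < z.re) : |(Complex.log z).im| < Real.pi / 2 := by
  rw [Complex.log_im]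
  exact Complex.abs_arg_lt_pi_div_two_iff.2 (Or.inl hz)

/-- The kernel integral with both rates given as complex numbers in the right half-plane. -/
theorem integral_besselKernel_log {ξ η : ℂ} (hξ : 0 < ξ.re) (hη : 0 < η.re) (δ : ℝ) {t : ℝ}
    (ht : 0 < t) :
    ∫ x : ℝ, besselKernel (Complex.log ξ) (Complex.log η + Real.log t) δ x =
      2 * ((t ^ (δ / 2) : ℝ) : ℂ) * (η / ξ) ^ ((δ / 2 : ℝ) : ℂ) *
        besselK |δ| (2 * ((t : ℂ) * ξ * η) ^ ((1 / 2 : ℝ) : ℂ)) := by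
  have hξ0 : ξ ≠ 0 := by rintro rfl; simp at hξ
  have hη0 : η ≠ 0 := by rintro rfl; simp at hη
  have ht0 : (t : ℂ) ≠ 0 := by exact_mod_cast ht.ne'
  have hA := abs_log_im_lt hξ
  have hB := abs_log_im_lt hη
  have hlogt : Complex.exp (Real.log t) = t := by
    rw [← Complex.ofReal_exp, Real.exp_log ht]
  have hdiv : Complex.log (η / ξ) = Complex.log η - Complex.log ξ := by
    rw [abs_lt] at hA hB
    rw [← Complex.log_exp (x := Complex.log η - Complex.log ξ), Complex.exp_sub,
      Complex.exp_log hη0, Complex.exp_log hξ0] <;> rw [Complex.sub_im] <;> linarith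
  have hmul : Complex.log (t * ξ * η) = Complex.log ξ + (Complex.log η + Real.log t) := by
    rw [abs_lt] at hA hB
    rw [← Complex.log_exp (x := Complex.log ξ + (Complex.log η + Real.log t)), Complex.exp_add,
      Complex.exp_add, hlogt, Complex.exp_log hη0, Complex.exp_log hξ0,
      show (t : ℂ) * ξ * η = ξ * (η * t) by ring] <;>
    rw [Complex.add_im, Complex.add_im, Complex.ofReal_im] <;> linarith
  rw [integral_besselKernel δ hA (by simpa using hB), besselK_abs,
    Complex.cpow_def_of_ne_zero (div_ne_zero hη0 hξ0),
    Complex.cpow_def_of_ne_zero (mul_ne_zero (mul_ne_zero ht0 hξ0) hη0), hdiv, hmul,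
    Real.rpow_def_of_pos ht, Complex.ofReal_exp, mul_assoc 2 (Complex.exp _) (Complex.exp _),
    ← Complex.exp_add]
  push_cast
  ring_nf

theorem pdf_of_product
    (α β : ℝ) (hα : 0 < α) (hβ : 0 < β)
    (M N : ℕ) (a : Fin M → ℂ) (b : Fin N → ℂ) (ξ : Fin M → ℂ) (η : Fin N → ℂ)
    (hξ : ∀ m, 0 < (ξ m).re) (hη : ∀ n, 0 < (η n).re)
    (f g : ℝ → ℝ)
    (hf : ∀ x > (0 : ℝ), ((f x : ℝ) : ℂ) =
      ((x ^ (α - 1) : ℝ) : ℂ) * ∑ m, a m * Complex.exp (-ξ m * x))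
    (hg : ∀ y > (0 : ℝ), ((g y : ℝ) : ℂ) =
      ((y ^ (β - 1) : ℝ) : ℂ) * ∑ n, b n * Complex.exp (-η n * y))
    (hf0 : ∀ x, 0 ≤ f x) (hg0 : ∀ y, 0 ≤ g y)
    (hf1 : ∫ x in Set.Ioi (0 : ℝ), f x = 1)
    (hg1 : ∫ y in Set.Ioi (0 : ℝ), g y = 1)
    (t : ℝ) (ht : 0 < t) :
    ((∫ x in Set.Ioi (0 : ℝ), f x * g (t / x) * (1 / x) : ℝ) : ℂ)
      = 2 * ((t ^ ((α + β - 2) / 2) : ℝ) : ℂ) *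
          ∑ m, ∑ n, a m * b n * (η n / ξ m) ^ (((α - β) / 2 : ℝ) : ℂ) *
            besselK |α - β| (2 * ((t : ℂ) * ξ m * η n) ^ ((1 / 2 : ℝ) : ℂ)) := by
  have hkernel : ∀ m n, ∀ τ : ℝ,
      besselKernel (Complex.log (ξ m)) (Complex.log (η n) + Real.log t) (α - β : ℝ) τ =
        Complex.exp (-ξ m * (Real.exp τ : ℝ)) * Complex.exp (-η n * (t / Real.exp τ : ℝ)) *
          ((Real.exp ((α - β) * τ) : ℝ) : ℂ) := by
    intro m n τ
    have hξ0 : ξ m ≠ 0 := fun h => by simpa [h] using hξ m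
    have hη0 : η n ≠ 0 := fun h => by simpa [h] using hη n
    have hlogt : Complex.exp (Real.log t) = t := by
      rw [← Complex.ofReal_exp, Real.exp_log ht]
    rw [besselKernel, Complex.exp_add (Complex.log (ξ m)), Complex.exp_sub (_ + _),
      Complex.exp_add (Complex.log (η n)), Complex.exp_log hξ0, Complex.exp_log hη0, hlogt,
      Complex.ofReal_exp ((α - β) * τ), ← Complex.exp_add, ← Complex.exp_add]
    push_cast
    ring_nf
  have hpow : ∀ τ : ℝ, Real.exp τ ^ (α - 1) * (t / Real.exp τ) ^ (β - 1) =
      t ^ (β - 1) * Real.exp ((α - β) * τ) := by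
    intro τ
    rw [Real.div_rpow ht.le (Real.exp_pos τ).le, ← Real.exp_mul, ← Real.exp_mul, mul_div_assoc',
      div_eq_iff (Real.exp_pos _).ne', mul_assoc, ← Real.exp_add, mul_comm]
    ring_nf
  have hpoint : ∀ τ : ℝ,
      ((Real.exp τ * (f (Real.exp τ) * g (t / Real.exp τ) * (1 / Real.exp τ)) : ℝ) : ℂ) =
        ∑ m, ∑ n, ((t ^ (β - 1) : ℝ) : ℂ) * (a m * b n) *
          besselKernel (Complex.log (ξ m)) (Complex.log (η n) + Real.log t) (α - β : ℝ) τ := by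
    intro τ
    have hτ := Real.exp_pos τ
    rw [show Real.exp τ * (f (Real.exp τ) * g (t / Real.exp τ) * (1 / Real.exp τ)) =
      f (Real.exp τ) * g (t / Real.exp τ) by field_simp, Complex.ofReal_mul, hf _ hτ,
      hg _ (div_pos ht hτ), mul_mul_mul_comm, ← Complex.ofReal_mul, hpow, Finset.sum_mul_sum,
      Finset.mul_sum]
    refine Finset.sum_congr rfl fun m _ => ?_
    rw [Finset.mul_sum]
    refine Finset.sum_congr rfl fun n _ => ?_
    rw [hkernel, Complex.ofReal_mul]
    ring
  have hint : ∀ m n, Integrable fun τ : ℝ => ((t ^ (β - 1) : ℝ) : ℂ) * (a m * b n) *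
      besselKernel (Complex.log (ξ m)) (Complex.log (η n) + Real.log t) (α - β : ℝ) τ :=
    fun m n => (integrable_besselKernel _ (abs_log_im_lt (hξ m))
      (by simpa using abs_log_im_lt (hη n))).const_mul _
  have hscale : t ^ (β - 1) * t ^ ((α - β) / 2) = t ^ ((α + β - 2) / 2) := by
    rw [← Real.rpow_add ht]
    ring_nf
  rw [integral_Ioi_eq_integral_exp, ← integral_complex_ofReal]
  simp only [hpoint]
  rw [integral_finsetSum _ fun m _ => integrable_finsetSum _ fun n _ => hint m n,
    Finset.mul_sum]
  refine Finset.sum_congr rfl fun m _ => ?_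
  rw [integral_finsetSum _ fun n _ => hint m n, Finset.mul_sum]
  refine Finset.sum_congr rfl fun n _ => ?_
  rw [integral_const_mul, integral_besselKernel_log (hξ m) (hη n) _ ht, ← hscale,
    Complex.ofReal_mul]
  ring
end

section
/- For real ν ≥ 0 and z > 0, K_ν(z) = √π (2z)^ν e^{−z} U(ν + 1/2, 1 + 2ν, 2z), where U is Tricomi's confluent hypergeometric function of the second kind. -/
open MeasureTheory

/-- Modified Bessel function of the second kind (real argument `x > 0`), via
`K_ν(x) = ∫_0^∞ exp(-x cosh t) cosh (ν t) dt`. -/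
noncomputable def besselKR (ν x : ℝ) : ℝ :=
  ∫ t in Set.Ioi (0 : ℝ), Real.exp (-x * Real.cosh t) * Real.cosh (ν * t)

/-- Tricomi's confluent hypergeometric function of the second kind, via the
integral representation `U(a,b,z) = Γ(a)⁻¹ ∫_0^∞ e^{-z t} t^{a-1} (1+t)^{b-a-1} dt`,
valid for `a > 0`, `z > 0`. -/
noncomputable def tricomiU (a b z : ℝ) : ℝ :=
  (Real.Gamma a)⁻¹ *
    ∫ t in Set.Ioi (0 : ℝ), Real.exp (-z * t) * t ^ (a - 1) * (1 + t) ^ (b - a - 1)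

open Set Real

theorem lintegral_eq_lintegral_Ioi_add_comp_neg {f : ℝ → ENNReal} (hf : Measurable f) :
    ∫⁻ t, f t = ∫⁻ t in Ioi (0 : ℝ), (f t + f (-t)) := by
  rw [lintegral_add_left hf, ← lintegral_add_compl f (measurableSet_Ioi (a := (0 : ℝ)))]
  congr 1
  have h := (Measure.measurePreserving_neg (volume : Measure ℝ)).setLIntegral_comp_preimage
    (measurableSet_Iio (a := (0 : ℝ))) hf
  rw [compl_Ioi, setLIntegral_congr Iio_ae_eq_Iic.symm, ← h]
  simp

theorem lintegral_exp_neg_half_mul_exp_neg_mul_cosh {w : ℝ} (hw : 0 < w) :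
    ∫⁻ t : ℝ, ENNReal.ofReal (exp (-t / 2) * exp (-w * cosh t))
      = ENNReal.ofReal (√(2 * π / w) * exp (-w)) := by
  have himage : (fun t : ℝ => sinh (t / 2)) '' Ioi 0 = Ioi 0 := by
    ext p
    simp only [mem_image, mem_Ioi]
    constructor
    · rintro ⟨t, ht, rfl⟩
      exact sinh_pos_iff.2 (by positivity)
    · intro hp
      exact ⟨2 * arsinh p, by have := arsinh_pos_iff.2 hp; positivity, by simp⟩
  have hsubst := lintegral_image_eq_lintegral_abs_deriv_mul (measurableSet_Ioi (a := (0 : ℝ)))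
    (f := fun t : ℝ => sinh (t / 2)) (f' := fun t => cosh (t / 2) * (1 / 2))
    (fun t _ => (((hasDerivAt_id t).div_const 2).sinh).hasDerivWithinAt)
    (fun s _ t _ h => by have := sinh_injective h; linarith)
    (fun p => ENNReal.ofReal (4 * exp (-w) * exp (-(2 * w) * p ^ 2)))
  rw [himage] at hsubst
  rw [lintegral_eq_lintegral_Ioi_add_comp_neg (by fun_prop)]
  trans ∫⁻ p in Ioi (0 : ℝ), ENNReal.ofReal (4 * exp (-w) * exp (-(2 * w) * p ^ 2))
  · rw [hsubst]
    refine lintegral_congr fun t => ?_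
    rw [← ENNReal.ofReal_add (by positivity) (by positivity),
      ← ENNReal.ofReal_mul (by positivity), abs_of_pos (by have := cosh_pos (t / 2); positivity)]
    congr 1
    have h1 : cosh t = 1 + 2 * sinh (t / 2) ^ 2 := by
      have h2 := cosh_two_mul (t / 2)
      rw [mul_div_cancel₀ t two_ne_zero, cosh_sq] at h2
      linarith
    have h3 : exp (-w * cosh t) = exp (-w) * exp (-(2 * w) * sinh (t / 2) ^ 2) := by
      rw [h1, ← exp_add]; ring_nf
    rw [cosh_neg, h3, cosh_eq (t / 2)]
    ring_nf
  · rw [← ofReal_integral_eq_lintegral_ofReal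
      (((integrable_exp_neg_mul_sq (by positivity)).const_mul _).integrableOn)
      (Filter.Eventually.of_forall fun p => by positivity), integral_const_mul,
      integral_gaussian_Ioi]
    congr 1
    have : √(2 * π / w) = 2 * √(π / (2 * w)) := by
      rw [show 2 * π / w = 2 ^ 2 * (π / (2 * w)) by field_simp, sqrt_mul (by positivity),
        sqrt_sq (by positivity)]
    rw [this]; ring

theorem lintegral_exp_neg_half_mul_exp_neg_half_mul {z u : ℝ} (hz : 0 < z) (hu : 0 < u) :
    ∫⁻ t : ℝ, ENNReal.ofReal (exp (-t / 2) * exp (-(z / 2) * (u ^ 2 * exp (-t) + exp t)))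
      = ENNReal.ofReal (√(2 * π / z) / u * exp (-z * u)) := by
  rw [← lintegral_add_right_eq_self _ (log u)]
  trans ∫⁻ t : ℝ, ENNReal.ofReal (√u)⁻¹ *
      ENNReal.ofReal (exp (-t / 2) * exp (-(z * u) * cosh t))
  · refine lintegral_congr fun t => ?_
    rw [← ENNReal.ofReal_mul (by positivity)]
    congr 1
    have h1 : exp (-(t + log u) / 2) = (√u)⁻¹ * exp (-t / 2) := by
      rw [show -(t + log u) / 2 = -(log u / 2) + -t / 2 by ring, exp_add, exp_neg, exp_half,
        exp_log hu]
    rw [h1, neg_add, exp_add, exp_add, exp_neg (log u), exp_log hu, cosh_eq, mul_assoc]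
    congr 3
    field_simp
    ring
  · rw [lintegral_const_mul _ (by fun_prop),
      lintegral_exp_neg_half_mul_exp_neg_mul_cosh (by positivity),
      ← ENNReal.ofReal_mul (by positivity)]
    congr 1
    rw [show 2 * π / (z * u) = 2 * π / z / u by field_simp, sqrt_div (by positivity),
      neg_mul]
    field_simp
    rw [sq_sqrt hu.le]

theorem lintegral_rpow_mul_exp_neg_mul_Ioi {a r : ℝ} (ha : 0 < a) (hr : 0 < r) :
    ∫⁻ v in Ioi (0 : ℝ), ENNReal.ofReal (v ^ (a - 1) * exp (-(r * v)))
      = ENNReal.ofReal ((1 / r) ^ a * Gamma a) := by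
  rw [← integral_rpow_mul_exp_neg_mul_Ioi ha hr, ofReal_integral_eq_lintegral_ofReal]
  · have h := integrableOn_rpow_mul_exp_neg_mul_rpow (s := a - 1) (p := 1) (b := r)
      (by linarith) one_pos hr
    simpa [IntegrableOn] using h
  · filter_upwards [ae_restrict_mem measurableSet_Ioi] with v hv
    have := mem_Ioi.1 hv
    positivity

theorem lintegral_Ioi_eq_lintegral_comp_four_mul_mul_one_add (g : ℝ → ENNReal) :
    ∫⁻ v in Ioi (0 : ℝ), g v
      = ∫⁻ s in Ioi (0 : ℝ), ENNReal.ofReal (4 * (1 + 2 * s)) * g (4 * (s * (1 + s))) := by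
  have himage : (fun s : ℝ => 4 * (s * (1 + s))) '' Ioi 0 = Ioi 0 := by
    ext v
    simp only [mem_image, mem_Ioi]
    constructor
    · rintro ⟨s, hs, rfl⟩
      positivity
    · intro hv
      have h1 : 1 < √(1 + v) := by
        rw [lt_sqrt (by norm_num)]; linarith
      refine ⟨(√(1 + v) - 1) / 2, by linarith, ?_⟩
      have h2 := sq_sqrt (show 0 ≤ 1 + v by linarith)
      linarith
  have hsubst := lintegral_image_eq_lintegral_abs_deriv_mul (measurableSet_Ioi (a := (0 : ℝ)))
    (f := fun s : ℝ => 4 * (s * (1 + s))) (f' := fun s => 4 * (1 + 2 * s))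
    (fun s _ => by
      have h := (((hasDerivAt_id s).mul ((hasDerivAt_id s).const_add 1)).const_mul 4)
      refine (h.congr_deriv ?_).hasDerivWithinAt
      simp only [id]; ring)
    (fun s hs t ht h => by
      have hs := mem_Ioi.1 hs
      have ht := mem_Ioi.1 ht
      have hst : (s - t) * (1 + s + t) = 0 := by
        simp only at h; linarith
      rcases mul_eq_zero.1 hst with h | h <;> linarith) g
  rw [himage] at hsubst
  rw [hsubst]
  refine setLIntegral_congr_fun measurableSet_Ioi fun s hs => ?_
  have := mem_Ioi.1 hs
  rw [abs_of_pos (by positivity)]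

theorem lintegral_exp_mul_exp_neg_mul_cosh {ν z : ℝ} (hν : 0 < ν + 1 / 2) (hz : 0 < z) :
    ∫⁻ t : ℝ, ENNReal.ofReal (Gamma (ν + 1 / 2) * (exp (ν * t) * exp (-z * cosh t)))
      = ∫⁻ v in Ioi (0 : ℝ), ENNReal.ofReal ((z / 2) ^ (ν + 1 / 2) * v ^ (ν - 1 / 2) *
          (√(2 * π / z) / √(1 + v) * exp (-z * √(1 + v)))) := by
  trans ∫⁻ t : ℝ, ∫⁻ v in Ioi (0 : ℝ), ENNReal.ofReal ((z / 2) ^ (ν + 1 / 2) * exp (-t / 2) *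
      exp (-z * cosh t)) *
      ENNReal.ofReal (v ^ (ν + 1 / 2 - 1) * exp (-(z / 2 * exp (-t) * v)))
  · refine lintegral_congr fun t => ?_
    rw [lintegral_const_mul _ (by fun_prop),
      lintegral_rpow_mul_exp_neg_mul_Ioi hν (by positivity), ← ENNReal.ofReal_mul (by positivity)]
    congr 1
    have h1 : (1 / (z / 2 * exp (-t))) ^ (ν + 1 / 2)
        = ((z / 2) ^ (ν + 1 / 2))⁻¹ * exp (t * (ν + 1 / 2)) := by
      rw [one_div, mul_inv, mul_rpow (by positivity) (by positivity), inv_rpow (by positivity),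
        ← exp_neg, neg_neg, exp_mul]
    have h2 : exp (ν * t) = exp (-t / 2) * exp (t * (ν + 1 / 2)) := by
      rw [← exp_add]; ring_nf
    rw [h1, h2]
    have : (z / 2) ^ (ν + 1 / 2) ≠ 0 := by positivity
    field_simp
  · rw [lintegral_lintegral_swap (by unfold Function.uncurry; fun_prop)]
    refine setLIntegral_congr_fun measurableSet_Ioi fun v hv => ?_
    have hv := mem_Ioi.1 hv
    rw [ENNReal.ofReal_mul (by positivity),
      ← lintegral_exp_neg_half_mul_exp_neg_half_mul hz (by positivity),
      ← lintegral_const_mul _ (by fun_prop)]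
    refine lintegral_congr fun t => ?_
    rw [← ENNReal.ofReal_mul (by positivity), ← ENNReal.ofReal_mul (by positivity)]
    congr 1
    have h : exp (-(z / 2) * (√(1 + v) ^ 2 * exp (-t) + exp t))
        = exp (-z * cosh t) * exp (-(z / 2 * exp (-t) * v)) := by
      rw [sq_sqrt (by positivity), ← exp_add, cosh_eq]; ring_nf
    rw [h]
    ring_nf

theorem lintegral_exp_neg_mul_cosh_mul_cosh {ν z : ℝ} (hν : 0 < ν + 1 / 2) (hz : 0 < z) :
    ∫⁻ t in Ioi (0 : ℝ), ENNReal.ofReal (exp (-z * cosh t) * cosh (ν * t))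
      = ∫⁻ s in Ioi (0 : ℝ), ENNReal.ofReal
          (√π * (2 * z) ^ ν * exp (-z) * ((Gamma (ν + 1 / 2))⁻¹ *
            (exp (-(2 * z) * s) * s ^ (ν + 1 / 2 - 1) *
              (1 + s) ^ (1 + 2 * ν - (ν + 1 / 2) - 1)))) := by
  have hΓ := Gamma_pos_of_pos hν
  have h := (lintegral_exp_mul_exp_neg_mul_cosh hν hz).trans
    (lintegral_Ioi_eq_lintegral_comp_four_mul_mul_one_add _)
  rw [lintegral_eq_lintegral_Ioi_add_comp_neg (by fun_prop)] at h
  have hscaled := congrArg (ENNReal.ofReal ((2 * Gamma (ν + 1 / 2))⁻¹) * ·) h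
  rw [← lintegral_const_mul _ (by fun_prop), ← lintegral_const_mul _ (by fun_prop)] at hscaled
  convert hscaled using 1
  · refine lintegral_congr fun t => ?_
    rw [← ENNReal.ofReal_add (by positivity) (by positivity), ← ENNReal.ofReal_mul (by positivity)]
    congr 1
    rw [cosh_neg, cosh_eq (ν * t)]
    generalize Gamma (ν + 1 / 2) = G at *
    field_simp
  · refine setLIntegral_congr_fun measurableSet_Ioi fun s hs => ?_
    have hs := mem_Ioi.1 hs
    rw [← ENNReal.ofReal_mul (by positivity), ← ENNReal.ofReal_mul (by positivity)]
    congr 1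
    have h1 : √(1 + 4 * (s * (1 + s))) = 1 + 2 * s := by
      rw [show 1 + 4 * (s * (1 + s)) = (1 + 2 * s) ^ 2 by ring, sqrt_sq (by positivity)]
    have h2 : exp (-z * (1 + 2 * s)) = exp (-z) * exp (-(2 * z) * s) := by
      rw [← exp_add]; ring_nf
    have h3 : (z / 2) ^ (ν + 1 / 2) * (4 : ℝ) ^ (ν - 1 / 2) * √(2 * π / z)
        = √π * (2 * z) ^ ν / 2 := by
      have h4 : (4 : ℝ) ^ (1 / 2 : ℝ) = 2 := by
        rw [← sqrt_eq_rpow, show (4 : ℝ) = 2 ^ 2 by norm_num, sqrt_sq (by norm_num)]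
      rw [rpow_add (by positivity), rpow_sub (by norm_num), h4, ← sqrt_eq_rpow,
        show 2 * z = z / 2 * 4 by ring, mul_rpow (by positivity) (by norm_num),
        show 2 * π / z = π / (z / 2) by field_simp, sqrt_div pi_pos.le]
      field_simp
    rw [h1, h2, mul_rpow (x := 4) (by norm_num) (by positivity), mul_rpow (x := s) hs.le (by positivity),
      show ν + 1 / 2 - 1 = ν - 1 / 2 by ring,
      show 1 + 2 * ν - (ν + 1 / 2) - 1 = ν - 1 / 2 by ring]
    generalize Gamma (ν + 1 / 2) = G at *
    generalize (z / 2) ^ (ν + 1 / 2) = A at *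
    generalize (4 : ℝ) ^ (ν - 1 / 2) = B at *
    generalize √(2 * π / z) = C at *
    rw [show √π * (2 * z) ^ ν = 2 * (A * B * C) by rw [h3]; ring]
    field_simp
    ring

theorem besselK_eq_tricomiU (ν z : ℝ) (hν : 0 ≤ ν) (hz : 0 < z) :
    besselKR ν z
      = Real.sqrt Real.pi * (2 * z) ^ ν * Real.exp (-z) *
          tricomiU (ν + 1 / 2) (1 + 2 * ν) (2 * z) := by
  have hΓ : 0 < Gamma (ν + 1 / 2) := Gamma_pos_of_pos (by positivity)
  unfold besselKR tricomiU
  rw [← integral_const_mul, ← integral_const_mul,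
    integral_eq_lintegral_of_nonneg_ae, integral_eq_lintegral_of_nonneg_ae,
    lintegral_exp_neg_mul_cosh_mul_cosh (by positivity) hz]
  · filter_upwards [ae_restrict_mem measurableSet_Ioi] with s hs
    have := mem_Ioi.1 hs
    simp only [Pi.zero_apply]
    positivity
  · exact Measurable.aestronglyMeasurable (by fun_prop)
  · exact Filter.Eventually.of_forall fun t => by
      have := cosh_pos (ν * t)
      simp only [Pi.zero_apply]
      positivity
  · exact Measurable.aestronglyMeasurable (by fun_prop)
end
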